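/- arXiv:2405.16825 — 3 statements merged into one kernel-verified Lean document; each statement's English description precedes it below -/
import Mathlib

section
/- Let (Ω, 𝓑, ℙ) be a probability space and (X_n) a sequence of integrable random variables. Then X_n converges conditionally in distribution to an integrable random variable X (i.e., for every measurable set A and every interval (a,b) with ℙ(X ∈ {a,b}) = 0, lim_{n→∞} ℙ(A ∩ {X_n ∈ (a,b)}) = ℙ(A)·ℙ(X ∈ (a,b))) if and only if for every fixed t ∈ ℝ, the random variables e^{itX_n} converge to the constant 𝔼(e^{itX}) weakly in L¹ (i.e., for every measurable set A, 𝔼(e^{itX_n}·χ_A) → 𝔼(e^{itX})·ℙ(A)). -/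
open MeasureTheory Filter Set

open scoped Topology ENNReal

/-- An s-finite measure on `ℝ` has null points in every nonempty open interval. -/
theorem exists_null_singleton_mem_Ioo (ν : Measure ℝ) [SFinite ν] {a b : ℝ} (hab : a < b) :
    ∃ c ∈ Ioo a b, ν {c} = 0 := by
  have hcount : {c : ℝ | 0 < ν {c}}.Countable :=
    Measure.countable_meas_pos_of_disjoint_iUnion (μ := ν) (As := fun c : ℝ => {c})
      (fun c => measurableSet_singleton c) (fun _ _ h => disjoint_singleton.2 h)
  obtain ⟨c, hc, hmem⟩ := (hcount.dense_compl ℝ).exists_between hab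
  exact ⟨c, hmem, by simpa using hc⟩

/-- Weak convergence of probability measures on `ℝ` is convergence on open intervals whose
endpoints are null for the limit. -/
theorem tendsto_probabilityMeasure_iff_Ioo (μ : ℕ → ProbabilityMeasure ℝ)
    (ν : ProbabilityMeasure ℝ) :
    Tendsto μ atTop (𝓝 ν) ↔
      ∀ a b : ℝ, (ν : Measure ℝ) {a, b} = 0 →
        Tendsto (fun n => (μ n : Measure ℝ) (Ioo a b)) atTop (𝓝 ((ν : Measure ℝ) (Ioo a b))) := by
  constructor
  · intro h a b hab
    refine ProbabilityMeasure.tendsto_measure_of_null_frontier_of_tendsto' h ?_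
    rcases lt_or_ge a b with hlt | hle
    · rwa [frontier_Ioo hlt]
    · simp [Ioo_eq_empty_of_le hle]
  · intro h
    have hS : IsPiSystem {s : Set ℝ | ∃ a b : ℝ, (ν : Measure ℝ) {a, b} = 0 ∧ s = Ioo a b} := by
      rintro _ ⟨a, b, hab, rfl⟩ _ ⟨c, d, hcd, rfl⟩ -
      refine ⟨max a c, min b d, measure_mono_null ?_ (measure_union_null hab hcd), Ioo_inter_Ioo⟩
      rcases max_choice a c with h₁ | h₁ <;> rcases min_choice b d with h₂ | h₂ <;>
        rw [h₁, h₂] <;> intro x <;> simp <;> tauto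
    refine hS.tendsto_probabilityMeasure_of_tendsto_of_mem ?_ ?_ ?_
    · rintro _ ⟨a, b, -, rfl⟩
      exact measurableSet_Ioo
    · intro u hu x hx
      obtain ⟨l, r, hlr, hsub⟩ := mem_nhds_iff_exists_Ioo_subset.1 (hu.mem_nhds hx)
      obtain ⟨a, ha, ha₀⟩ := exists_null_singleton_mem_Ioo (ν : Measure ℝ) hlr.1
      obtain ⟨b, hb, hb₀⟩ := exists_null_singleton_mem_Ioo (ν : Measure ℝ) hlr.2
      exact ⟨Ioo a b, ⟨a, b, measure_union_null ha₀ hb₀, rfl⟩, Ioo_mem_nhds ha.2 hb.1,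
        (Ioo_subset_Ioo ha.1.le hb.2.le).trans hsub⟩
    · rintro _ ⟨a, b, hab, rfl⟩
      exact (ENNReal.tendsto_toNNReal (measure_ne_top _ _)).comp (h a b hab)

/-- The characteristic function of the law of a real random variable. -/
theorem charFun_map_eq_integral {Ω : Type*} [MeasurableSpace Ω] {P : Measure Ω} {Y : Ω → ℝ}
    (hY : AEMeasurable Y P) (t : ℝ) :
    charFun (P.map Y) t = ∫ ω, Complex.exp (Complex.I * (t : ℂ) * (Y ω : ℂ)) ∂P := by
  rw [charFun_apply_real, integral_map hY (by fun_prop)]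
  congr with ω
  ring_nf

/-- For a fixed set `A` of positive measure, convergence on `A` of the interval probabilities is
equivalent to convergence on `A` of the characteristic functions. -/
theorem tendsto_measure_inter_Ioo_iff_tendsto_setIntegral_exp
    {Ω : Type*} [MeasurableSpace Ω] {P : Measure Ω} [IsProbabilityMeasure P]
    {Xn : ℕ → Ω → ℝ} {X : Ω → ℝ} (hXn : ∀ n, AEMeasurable (Xn n) P) (hX : AEMeasurable X P)
    {A : Set Ω} (hA : MeasurableSet A) (hPA : P A ≠ 0) :
    (∀ a b : ℝ, P {ω | X ω ∈ ({a, b} : Set ℝ)} = 0 →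
        Tendsto (fun n => P (A ∩ {ω | Xn n ω ∈ Ioo a b})) atTop
          (𝓝 (P A * P {ω | X ω ∈ Ioo a b})))
    ↔ ∀ t : ℝ,
        Tendsto (fun n => ∫ ω in A, Complex.exp (Complex.I * (t : ℂ) * (Xn n ω : ℂ)) ∂P)
          atTop
          (𝓝 ((∫ ω, Complex.exp (Complex.I * (t : ℂ) * (X ω : ℂ)) ∂P) * ((P A).toReal : ℂ))) := by
  have := ProbabilityTheory.cond_isProbabilityMeasure hPA
  have hPA' : P A ≠ ∞ := measure_ne_top P A
  have hc : ((P A).toReal : ℂ) ≠ 0 := by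
    exact_mod_cast (ENNReal.toReal_pos hPA hPA').ne'
  have hXn' (n : ℕ) : AEMeasurable (Xn n) (ProbabilityTheory.cond P A) :=
    (hXn n).mono_ac ProbabilityTheory.cond_absolutelyContinuous
  let μ (n : ℕ) : ProbabilityMeasure ℝ :=
    ⟨(ProbabilityTheory.cond P A).map (Xn n), Measure.isProbabilityMeasure_map (hXn' n)⟩
  let ν : ProbabilityMeasure ℝ := ⟨P.map X, Measure.isProbabilityMeasure_map hX⟩
  have hμ (n : ℕ) (a b : ℝ) :
      (μ n : Measure ℝ) (Ioo a b) = (P A)⁻¹ * P (A ∩ {ω | Xn n ω ∈ Ioo a b}) := by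
    change (ProbabilityTheory.cond P A).map (Xn n) (Ioo a b) = _
    rw [Measure.map_apply_of_aemeasurable (hXn' n) measurableSet_Ioo,
      ProbabilityTheory.cond_apply hA]
    rfl
  have hν {s : Set ℝ} (hs : MeasurableSet s) : (ν : Measure ℝ) s = P {ω | X ω ∈ s} :=
    Measure.map_apply_of_aemeasurable hX hs
  have hμc (n : ℕ) (t : ℝ) : charFun (μ n : Measure ℝ) t = ((P A).toReal : ℂ)⁻¹ *
      ∫ ω in A, Complex.exp (Complex.I * (t : ℂ) * (Xn n ω : ℂ)) ∂P := by
    change charFun ((ProbabilityTheory.cond P A).map (Xn n)) t = _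
    rw [charFun_map_eq_integral (hXn' n), ProbabilityTheory.cond, integral_smul_measure]
    simp
  have hνc (t : ℝ) : charFun (ν : Measure ℝ) t =
      ∫ ω, Complex.exp (Complex.I * (t : ℂ) * (X ω : ℂ)) ∂P := charFun_map_eq_integral hX t
  have key := (tendsto_probabilityMeasure_iff_Ioo μ ν).symm.trans
    ProbabilityMeasure.tendsto_iff_tendsto_charFun
  have hpair (a b : ℝ) : MeasurableSet ({a, b} : Set ℝ) := (Set.toFinite _).measurableSet
  simp only [hμ, hμc, hνc, hν measurableSet_Ioo, hν (hpair _ _)] at key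
  refine (forall₃_congr fun a b _ => ?_).trans (key.trans (forall_congr' fun t => ?_))
  · constructor <;> intro h
    · convert! ENNReal.Tendsto.const_mul (a := (P A)⁻¹) h (.inr (by simpa using hPA)) using 2
      rw [← mul_assoc, ENNReal.inv_mul_cancel hPA hPA', one_mul]
    · convert! ENNReal.Tendsto.const_mul (a := P A) h (.inr hPA') using 2
      rw [← mul_assoc, ENNReal.mul_inv_cancel hPA hPA', one_mul]
  · constructor <;> intro h
    · convert! h.const_mul ((P A).toReal : ℂ) using 2
      · field_simp
      · ring
    · convert! h.const_mul ((P A).toReal : ℂ)⁻¹ using 2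
      field_simp

/-- **Lemma (lemma:tech).** A sequence of integrable random variables `Xn` converges
conditionally in distribution to an integrable random variable `X` (conditioning on
arbitrary measurable sets) if and only if, for every `t : ℝ`, the random variables
`exp(i t Xn)` converge weakly in `L¹` to the constant `E(exp(i t X))`. -/
theorem conditional_convergence_iff_weakL1
    {Ω : Type*} [MeasurableSpace Ω] (P : Measure Ω) [IsProbabilityMeasure P]
    (Xn : ℕ → Ω → ℝ) (X : Ω → ℝ)
    (hXn : ∀ n, Integrable (Xn n) P) (hX : Integrable X P) :
    (∀ A : Set Ω, MeasurableSet A → ∀ a b : ℝ, P {ω | X ω ∈ ({a, b} : Set ℝ)} = 0 →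
        Tendsto (fun n => P (A ∩ {ω | Xn n ω ∈ Ioo a b})) atTop
          (nhds (P A * P {ω | X ω ∈ Ioo a b})))
    ↔ (∀ t : ℝ, ∀ A : Set Ω, MeasurableSet A →
        Tendsto (fun n => ∫ ω in A, Complex.exp (Complex.I * (t : ℂ) * (Xn n ω : ℂ)) ∂P)
          atTop
          (nhds ((∫ ω, Complex.exp (Complex.I * (t : ℂ) * (X ω : ℂ)) ∂P)
            * ((P A).toReal : ℂ)))) := by
  have key {A : Set Ω} (hA : MeasurableSet A) (hPA : P A ≠ 0) :=
    tendsto_measure_inter_Ioo_iff_tendsto_setIntegral_exp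
      (fun n => (hXn n).aemeasurable) hX.aemeasurable hA hPA
  constructor
  · intro h t A hA
    by_cases hPA : P A = 0
    · simp [Measure.restrict_eq_zero.2 hPA, hPA]
    · exact (key hA hPA).1 (h A hA) t
  · intro h A hA a b hab
    by_cases hPA : P A = 0
    · simp [measure_inter_null_of_null_left _ hPA, hPA]
    · exact (key hA hPA).2 (fun t => h t A hA) a b hab
end

section
/- Let (X, d) be a metric space with Borel probability measure μ, T : X → X invertible and measure-preserving, and f : X → ℝ bounded measurable. Suppose the Birkhoff sums S_N(x) = (∑_{n=0}^{N-1} f(T^n x) − A_N)/V_N converge in distribution to S, with V_N → ∞. Suppose there exists a measure-preserving ergodic transformation U : X → X such that (T, U) is contracting and f is (T, U, 𝒱)-adapted, meaning that for μ-a.e. x, ∑_{n=0}^{N} |f(T^n U x) − f(T^n x)| = o_x(V_N). Then the distributional limit theorem holds in the mixing sense: for all Borel sets A, B ⊆ X and every interval (a,b) with ℙ(S ∈ {a,b}) = 0, lim_{N→∞} μ({x : x ∈ A, S_N(x) ∈ (a,b), T^N x ∈ B}) = μ(A)·ℙ(S ∈ (a,b))·μ(B). -/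
open MeasureTheory Filter Set

open scoped Topology

/-- The mean ergodic theorem for square-integrable observables of an ergodic map, in `L¹`. -/
theorem Ergodic.tendsto_integral_abs_birkhoffAverage_sub {Ω : Type*} [MeasurableSpace Ω]
    {μ : Measure Ω} [IsProbabilityMeasure μ] {P : Ω → Ω} (hP : Ergodic P μ) {a : Ω → ℝ}
    (ha : MemLp a 2 μ) :
    Tendsto (fun n => ∫ x, |birkhoffAverage ℝ P a n x - ∫ y, a y ∂μ| ∂μ) atTop (𝓝 0) := by
  have hPm : MeasurePreserving P μ μ := hP.toMeasurePreserving
  set W : Lp ℝ 2 μ →L[ℝ] Lp ℝ 2 μ :=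
    (Lp.compMeasurePreservingₗᵢ ℝ P hPm).toContinuousLinearMap
  have hiter : ∀ k, W^[k] (ha.toLp a) = (ha.comp_measurePreserving (hPm.iterate k)).toLp _ := by
    intro k
    induction k with
    | zero => rfl
    | succ k ih =>
      rw [Function.iterate_succ_apply', ih]
      rfl
  have hmem : ∀ k, MemLp (a ∘ P^[k]) 2 μ := fun k => ha.comp_measurePreserving (hPm.iterate k)
  have hsum : ∀ n, ∃ h : MemLp (birkhoffSum P a n) 2 μ,
      birkhoffSum W id n (ha.toLp a) = h.toLp _ := by
    intro n
    induction n with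
    | zero =>
      refine ⟨by simp, ?_⟩
      simp [birkhoffSum_zero']
    | succ n ih =>
      obtain ⟨h, e⟩ := ih
      have e' : birkhoffSum P a (n + 1) = birkhoffSum P a n + a ∘ P^[n] := by
        ext x; simp [birkhoffSum_succ]
      refine ⟨e' ▸ h.add (hmem n), ?_⟩
      rw [birkhoffSum_succ, e, id, hiter, ← MemLp.toLp_add]
      congr 1
      exact e'.symm
  have havg : ∀ n, ∃ h : MemLp (birkhoffAverage ℝ P a n) 2 μ,
      birkhoffAverage ℝ W id n (ha.toLp a) = h.toLp _ := by
    intro n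
    obtain ⟨h, e⟩ := hsum n
    exact ⟨h.const_smul ((n : ℝ)⁻¹), by rw [birkhoffAverage, e]; rfl⟩
  choose hA heA using havg
  have hlim := W.tendsto_birkhoffAverage_orthogonalProjection
    (LinearIsometry.norm_toContinuousLinearMap_le _) (ha.toLp a)
  set z : Lp ℝ 2 μ := ((W.eqLocus (1 : Lp ℝ 2 μ →L[ℝ] Lp ℝ 2 μ)).orthogonalProjectionOnto
    (ha.toLp a)).1
  have hWz : W z = z := ((W.eqLocus (1 : Lp ℝ 2 μ →L[ℝ] Lp ℝ 2 μ)).orthogonalProjectionOnto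
    (ha.toLp a)).2
  obtain ⟨c, hc⟩ : ∃ c, (z : Ω → ℝ) =ᵐ[μ] Function.const Ω c := by
    refine hP.ae_eq_const_of_ae_eq_comp_ae (Lp.aestronglyMeasurable z) ?_
    have := Lp.coeFn_compMeasurePreserving z hPm
    refine this.symm.trans ?_
    change (W z : Ω → ℝ) =ᵐ[μ] z
    rw [hWz]
  have hbound : ∀ n, ∫ x, |birkhoffAverage ℝ P a n x - c| ∂μ
      ≤ ‖birkhoffAverage ℝ W id n (ha.toLp a) - z‖ := by
    intro n
    have hm : MemLp (fun x => birkhoffAverage ℝ P a n x - c) 2 μ := (hA n).sub (memLp_const c)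
    have e : birkhoffAverage ℝ W id n (ha.toLp a) - z = hm.toLp _ := by
      rw [heA]
      ext1
      filter_upwards [Lp.coeFn_sub ((hA n).toLp _) z, (hA n).coeFn_toLp, hm.coeFn_toLp, hc]
        with x h1 h2 h3 h4
      rw [h1, h3, Pi.sub_apply, h2, h4, Function.const_apply]
    rw [e, Lp.norm_toLp]
    have h1 := integral_norm_eq_lintegral_enorm hm.1
    simp only [Real.norm_eq_abs] at h1
    rw [h1, ← eLpNorm_one_eq_lintegral_enorm]
    exact ENNReal.toReal_mono hm.2.ne (eLpNorm_le_eLpNorm_of_exponent_le (by norm_num) hm.1)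
  have hto : Tendsto (fun n => ∫ x, |birkhoffAverage ℝ P a n x - c| ∂μ) atTop (𝓝 0) :=
    squeeze_zero (fun n => integral_nonneg fun x => abs_nonneg _) hbound
      (tendsto_iff_norm_sub_tendsto_zero.1 hlim)
  have hint : ∀ n, 0 < n → ∫ x, birkhoffAverage ℝ P a n x ∂μ = ∫ y, a y ∂μ := by
    intro n hn
    simp only [birkhoffAverage, birkhoffSum, smul_eq_mul]
    rw [integral_const_mul, integral_finsetSum]
    · have : ∀ k, ∫ x, a (P^[k] x) ∂μ = ∫ y, a y ∂μ := fun k => by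
        have := integral_map (hPm.iterate k).aemeasurable (f := a)
          (by rw [(hPm.iterate k).map_eq]; exact ha.1)
        rw [← this, (hPm.iterate k).map_eq]
      simp only [this, Finset.sum_const, Finset.card_range, nsmul_eq_mul]
      field_simp
    · exact fun k _ => (hmem k).integrable (by norm_num)
  have hcon : Tendsto (fun _ : ℕ => |(∫ y, a y ∂μ) - c|) atTop (𝓝 0) := by
    refine squeeze_zero' (.of_forall fun _ => abs_nonneg _) ?_ hto
    filter_upwards [eventually_gt_atTop 0] with n hn
    have := abs_integral_le_integral_abs (f := fun x => birkhoffAverage ℝ P a n x - c) (μ := μ)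
    rwa [integral_sub ((hA n).integrable (by norm_num)) (integrable_const c), hint n hn,
      integral_const, probReal_univ, one_smul] at this
  have hc' : (∫ y, a y ∂μ) = c := by
    have := tendsto_nhds_unique hcon tendsto_const_nhds
    exact sub_eq_zero.1 (abs_eq_zero.1 this.symm)
  rwa [hc']

/-- If `P` is ergodic, commutes with the maps `τ N`, and `φ N` is asymptotically `P`-invariant, then
`a ∘ τ N` and `φ N` are asymptotically uncorrelated. -/
theorem Ergodic.tendsto_integral_mul_sub {Ω : Type*} [MeasurableSpace Ω]
    {μ : Measure Ω} [IsProbabilityMeasure μ] {P : Ω → Ω} (hP : Ergodic P μ)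
    {τ : ℕ → Ω → Ω} (hτ : ∀ N, MeasurePreserving (τ N) μ μ)
    (hcomm : ∀ N x, τ N (P x) = P (τ N x))
    {φ : ℕ → Ω → ℝ} (hφm : ∀ N, Measurable (φ N)) (hφb : ∀ N x, |φ N x| ≤ 1)
    (hφ : ∀ᵐ x ∂μ, Tendsto (fun N => φ N (P x) - φ N x) atTop (𝓝 0))
    {a : Ω → ℝ} (ham : Measurable a) (hab : ∀ x, |a x| ≤ 1) :
    Tendsto (fun N => (∫ x, a (τ N x) * φ N x ∂μ) - (∫ x, a x ∂μ) * ∫ x, φ N x ∂μ)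
      atTop (𝓝 0) := by
  have hPm : MeasurePreserving P μ μ := hP.toMeasurePreserving
  have hbdd : ∀ {g : Ω → ℝ}, Measurable g → (∀ x, |g x| ≤ 1) → Integrable g μ := fun hg hb =>
    Integrable.of_bound hg.aestronglyMeasurable 1 (.of_forall hb)
  have hmulb : ∀ {s t : ℝ}, |s| ≤ 1 → |t| ≤ 1 → |s * t| ≤ 1 := fun hs ht => by
    rw [abs_mul]; exact mul_le_one₀ hs (abs_nonneg _) ht
  have hint : ∀ {b : Ω → ℝ}, Measurable b → (∀ x, |b x| ≤ 1) → ∀ N,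
      Integrable (fun x => b (τ N x) * φ N x) μ := fun hb hb1 N =>
    hbdd ((hb.comp (hτ N).measurable).mul (hφm N)) fun x => hmulb (hb1 _) (hφb N x)
  have hstep : ∀ {b : Ω → ℝ}, Measurable b → (∀ x, |b x| ≤ 1) →
      Tendsto (fun N => (∫ x, b (P (τ N x)) * φ N x ∂μ) - ∫ x, b (τ N x) * φ N x ∂μ)
        atTop (𝓝 0) := by
    intro b hb hb1
    have e : ∀ N, (∫ x, b (P (τ N x)) * φ N x ∂μ) - ∫ x, b (τ N x) * φ N x ∂μ
        = ∫ x, b (P (τ N x)) * (φ N x - φ N (P x)) ∂μ := by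
      intro N
      have h1 : ∫ x, b (τ N x) * φ N x ∂μ = ∫ x, b (P (τ N x)) * φ N (P x) ∂μ := by
        have := integral_map hPm.aemeasurable (f := fun x => b (τ N x) * φ N x)
          ((hb.comp (hτ N).measurable).mul (hφm N)).aestronglyMeasurable
        rw [hPm.map_eq] at this
        simpa only [hcomm] using this
      rw [h1, ← integral_sub
        (hint (b := fun x => b (P x)) (hb.comp hPm.measurable) (fun x => hb1 _) N)]
      · simp only [mul_sub]
      · exact hbdd ((hb.comp (hPm.measurable.comp (hτ N).measurable)).mul
          ((hφm N).comp hPm.measurable)) fun x => hmulb (hb1 _) (hφb N _)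
    simp only [e]
    rw [show (0 : ℝ) = ∫ _, (0 : ℝ) ∂μ by simp]
    refine tendsto_integral_of_dominated_convergence (fun _ => 2) (fun N => ?_)
      (integrable_const _) (fun N => .of_forall fun x => ?_) ?_
    · exact ((hb.comp (hPm.measurable.comp (hτ N).measurable)).mul
          ((hφm N).sub ((hφm N).comp hPm.measurable))).aestronglyMeasurable
    · rw [Real.norm_eq_abs, abs_mul]
      have h1 := hb1 (P (τ N x))
      have h2 : |φ N x - φ N (P x)| ≤ 2 :=
        (abs_sub _ _).trans (by linarith [hφb N x, hφb N (P x)])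
      nlinarith [abs_nonneg (b (P (τ N x))), abs_nonneg (φ N x - φ N (P x))]
    · filter_upwards [hφ] with x hx
      refine squeeze_zero_norm (fun N => ?_) (tendsto_zero_iff_norm_tendsto_zero.1 hx)
      rw [norm_mul, norm_sub_rev]
      exact mul_le_of_le_one_left (norm_nonneg _) (hb1 _)
  have hcm : ∀ j, Measurable fun x => a (P^[j] x) := fun j => ham.comp (hPm.iterate j).measurable
  have hpow : ∀ j, Tendsto (fun N => (∫ x, a (P^[j] (τ N x)) * φ N x ∂μ)
      - ∫ x, a (τ N x) * φ N x ∂μ) atTop (𝓝 0) := by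
    intro j
    induction j with
    | zero => simp
    | succ j ih =>
      have := (hstep (hcm j) fun x => hab _).add ih
      simpa only [← Function.iterate_succ_apply, sub_add_sub_cancel, add_zero] using this
  rw [Metric.tendsto_atTop]
  intro ε hε
  have hmean := hP.tendsto_integral_abs_birkhoffAverage_sub (a := a)
    (MemLp.of_bound ham.aestronglyMeasurable 1 (.of_forall hab))
  obtain ⟨n, hn, hn0⟩ := ((hmean.eventually_lt_const (half_pos hε)).and
    (eventually_gt_atTop 0)).exists
  have hbirk : Measurable (birkhoffAverage ℝ P a n) := by
    unfold birkhoffAverage birkhoffSum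
    exact (Finset.measurable_sum _ fun k _ => hcm k).const_smul ((n : ℝ)⁻¹)
  have havg : Tendsto (fun N => (∫ x, birkhoffAverage ℝ P a n (τ N x) * φ N x ∂μ)
      - ∫ x, a (τ N x) * φ N x ∂μ) atTop (𝓝 0) := by
    have := (tendsto_finsetSum (Finset.range n) fun j _ => hpow j).const_mul ((n : ℝ)⁻¹)
    simp only [Finset.sum_const_zero, mul_zero] at this
    refine this.congr fun N => ?_
    simp only [birkhoffAverage, birkhoffSum, smul_eq_mul, mul_assoc, Finset.sum_mul]
    rw [integral_const_mul, integral_finsetSum _ fun j _ =>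
      hint (hcm j) (fun x => hab _) N, Finset.sum_sub_distrib, mul_sub]
    simp only [Finset.sum_const, Finset.card_range, nsmul_eq_mul]
    field_simp
  obtain ⟨N₀, hN₀⟩ := Metric.tendsto_atTop.1 havg (ε / 2) (half_pos hε)
  refine ⟨N₀, fun N hN => ?_⟩
  specialize hN₀ N hN
  rw [Real.dist_eq, sub_zero] at hN₀ ⊢
  have hbi : Integrable (birkhoffAverage ℝ P a n) μ := by
    unfold birkhoffAverage birkhoffSum
    exact (integrable_finsetSum _ fun k _ =>
      hbdd (hcm k) fun x => hab _).smul ((n : ℝ)⁻¹)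
  have hbτ : Integrable (fun x => birkhoffAverage ℝ P a n (τ N x)) μ :=
    (hτ N).integrable_comp_of_integrable hbi
  have hbφ : Integrable (fun x => birkhoffAverage ℝ P a n (τ N x) * φ N x) μ :=
    hbτ.mul_bdd (c := 1) (hφm N).aestronglyMeasurable (.of_forall (hφb N))
  have hmain : |(∫ x, birkhoffAverage ℝ P a n (τ N x) * φ N x ∂μ)
      - (∫ x, a x ∂μ) * ∫ x, φ N x ∂μ| < ε / 2 := by
    rw [← integral_const_mul, ← integral_sub hbφ ((hbdd (hφm N) (hφb N)).const_mul _)]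
    refine abs_integral_le_integral_abs.trans_lt (lt_of_le_of_lt ?_ hn)
    have := integral_map (hτ N).aemeasurable
      (f := fun x => |birkhoffAverage ℝ P a n x - ∫ y, a y ∂μ|)
      (hbirk.sub_const _).abs.aestronglyMeasurable
    rw [(hτ N).map_eq] at this
    rw [this]
    refine integral_mono (hbφ.sub ((hbdd (hφm N) (hφb N)).const_mul _)).abs
      (hbτ.sub (integrable_const _)).abs fun x => ?_
    simp only [← sub_mul, abs_mul]
    exact mul_le_of_le_one_right (abs_nonneg _) (hφb N x)
  rw [abs_lt] at *
  constructor <;> linarith [hmain.1, hmain.2, hN₀.1, hN₀.2]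

theorem tendsto_zero_of_forall_eventually_abs_sub_le {u : ℕ → ℝ}
    (h : ∀ ε > 0, ∃ v : ℕ → ℝ, Tendsto v atTop (𝓝 0) ∧ ∀ᶠ N in atTop, |u N - v N| ≤ ε) :
    Tendsto u atTop (𝓝 0) := by
  rw [Metric.tendsto_nhds]
  intro ε hε
  obtain ⟨v, hv, huv⟩ := h (ε / 2) (half_pos hε)
  filter_upwards [huv, (Metric.tendsto_nhds.1 hv) (ε / 2) (half_pos hε)] with N h1 h2
  rw [Real.dist_eq, sub_zero] at *
  calc |u N| = |(u N - v N) + v N| := by ring_nf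
    _ ≤ |u N - v N| + |v N| := abs_add_le _ _
    _ < ε := by linarith

theorem uniformContinuous_coe_thickenedIndicator {X : Type*} [PseudoEMetricSpace X] {δ : ℝ}
    (hδ : 0 < δ) (s : Set X) : UniformContinuous fun x => (thickenedIndicator hδ s x : ℝ) :=
  uniformContinuous_subtype_val.comp (lipschitzWith_thickenedIndicator hδ s).uniformContinuous

theorem abs_coe_thickenedIndicator_le_one {X : Type*} [PseudoEMetricSpace X] {δ : ℝ}
    (hδ : 0 < δ) (s : Set X) (x : X) : |(thickenedIndicator hδ s x : ℝ)| ≤ 1 := by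
  rw [abs_of_nonneg (NNReal.coe_nonneg _)]
  exact_mod_cast thickenedIndicator_le_one hδ s x

/-- Indicators of measurable sets are `L¹`-limits of uniformly continuous functions. -/
theorem exists_uniformContinuous_integral_abs_sub_indicator_le {X : Type*} [MetricSpace X]
    [MeasurableSpace X] [BorelSpace X] (μ : Measure X) [IsFiniteMeasure μ] {B : Set X}
    (hB : MeasurableSet B) {ε : ℝ} (hε : 0 < ε) :
    ∃ g : X → ℝ, UniformContinuous g ∧ (∀ x, |g x| ≤ 1) ∧
      ∫ x, |B.indicator 1 x - g x| ∂μ ≤ ε := by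
  obtain ⟨F, hFB, hF, hFε⟩ := hB.exists_isClosed_sdiff_lt (measure_ne_top μ B)
    (ENNReal.ofReal_pos.2 (half_pos hε)).ne'
  have hlim := tendsto_measure_thickening_of_isClosed (μ := μ) (s := F)
    ⟨1, one_pos, measure_ne_top _ _⟩ hF
  have hlt : μ F < μ F + ENNReal.ofReal (ε / 2) :=
    ENNReal.lt_add_right (measure_ne_top _ _) (ENNReal.ofReal_pos.2 (half_pos hε)).ne'
  obtain ⟨δ, hδμ, (hδ : 0 < δ)⟩ := ((hlim.eventually_lt_const hlt).and self_mem_nhdsWithin).exists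
  have hFδ : F ⊆ Metric.thickening δ F := Metric.self_subset_thickening hδ F
  have hth : MeasurableSet (Metric.thickening δ F) := Metric.isOpen_thickening.measurableSet
  refine ⟨_, uniformContinuous_coe_thickenedIndicator hδ F,
    abs_coe_thickenedIndicator_le_one hδ F, ?_⟩
  set g : X → ℝ := fun x => (thickenedIndicator hδ F x : ℝ)
  have h1 : μ.real (B \ F) ≤ ε / 2 :=
    ENNReal.toReal_le_of_le_ofReal (half_pos hε).le hFε.le
  have h2 : μ.real (Metric.thickening δ F \ F) ≤ ε / 2 := by
    refine ENNReal.toReal_le_of_le_ofReal (half_pos hε).le ?_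
    rw [measure_sdiff hFδ hF.measurableSet.nullMeasurableSet (measure_ne_top _ _)]
    exact tsub_le_iff_left.2 hδμ.le
  have hi : ∀ {s : Set X}, MeasurableSet s → Integrable (s.indicator (1 : X → ℝ)) μ := fun hs =>
    (integrable_const (1 : ℝ)).indicator hs
  have hgm : Measurable g := (uniformContinuous_coe_thickenedIndicator hδ F).continuous.measurable
  calc ∫ x, |B.indicator 1 x - g x| ∂μ
      ≤ ∫ x, ((B \ F).indicator 1 x + (Metric.thickening δ F \ F).indicator 1 x) ∂μ := by
        refine integral_mono ((hi hB).sub (Integrable.of_bound hgm.aestronglyMeasurable 1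
          (.of_forall (abs_coe_thickenedIndicator_le_one hδ F)))).abs
          ((hi (hB.diff hF.measurableSet)).add (hi (hth.diff hF.measurableSet))) fun x => ?_
        have g0 : 0 ≤ g x := NNReal.coe_nonneg _
        have g1 : g x ≤ 1 := (le_abs_self _).trans (abs_coe_thickenedIndicator_le_one hδ F x)
        by_cases hxF : x ∈ F
        · have : g x = 1 := congrArg NNReal.toReal (thickenedIndicator_one hδ F hxF)
          simp [hxF, hFB hxF, this]
        · by_cases hxt : x ∈ Metric.thickening δ F
          · by_cases hxB : x ∈ B <;> simp [hxF, hxt, hxB] <;> rw [abs_le] <;>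
              constructor <;> linarith
          · have : g x = 0 := congrArg NNReal.toReal (thickenedIndicator_zero hδ F hxt)
            by_cases hxB : x ∈ B <;> simp [hxF, hxt, hxB, this]
    _ = μ.real (B \ F) + μ.real (Metric.thickening δ F \ F) := by
        rw [integral_add (hi (hB.diff hF.measurableSet)) (hi (hth.diff hF.measurableSet)),
          integral_indicator_one (hB.diff hF.measurableSet),
          integral_indicator_one (hth.diff hF.measurableSet)]
    _ ≤ ε := by linarith

/-- A law on `ℝ` without atoms at `a` and `b` has arbitrarily small mass on symmetric intervals
around `a` and `b` whose endpoints are not atoms. -/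
theorem exists_pos_measureReal_Ioo_lt (S : Measure ℝ) [IsFiniteMeasure S] {a b : ℝ}
    (hab : S {a, b} = 0) {ε : ℝ} (hε : 0 < ε) :
    ∃ δ > 0, ∀ c ∈ ({a, b} : Set ℝ), S {c - δ, c + δ} = 0 ∧ S.real (Ioo (c - δ) (c + δ)) < ε := by
  have hsmall : ∀ c ∈ ({a, b} : Set ℝ), ∀ᶠ δ in 𝓝[>] (0 : ℝ),
      S.real (Ioo (c - δ) (c + δ)) < ε := by
    intro c hc
    have hc0 : S {c} = 0 := measure_mono_null (singleton_subset_iff.2 hc) hab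
    have hlim := tendsto_measure_thickening_of_isClosed (μ := S) (s := {c})
      ⟨1, one_pos, measure_ne_top _ _⟩ isClosed_singleton
    rw [hc0] at hlim
    filter_upwards [hlim.eventually_lt_const (ENNReal.ofReal_pos.2 hε)] with δ hδ
    rw [Metric.thickening_singleton, Real.ball_eq_Ioo] at hδ
    exact ENNReal.toReal_lt_of_lt_ofReal hδ
  have hat : {x : ℝ | 0 < S {x}}.Countable :=
    Measure.countable_meas_pos_of_disjoint_iUnion (fun _ => measurableSet_singleton _)
      fun x y hxy => disjoint_singleton.2 hxy
  have hbad : ∀ c : ℝ, {δ : ℝ | S {c - δ, c + δ} ≠ 0}.Countable := by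
    intro c
    refine ((hat.preimage (sub_right_injective (b := c))).union
      (hat.preimage (add_right_injective c))).mono fun δ hδ => ?_
    by_contra hcon
    simp only [mem_union, mem_preimage, mem_ofPred_eq, not_or, not_lt, nonpos_iff_eq_zero] at hcon
    exact hδ (measure_union_null hcon.1 hcon.2)
  obtain ⟨δ₀, hδ₀, hsub⟩ := mem_nhdsGT_iff_exists_Ioo_subset.1
    ((hsmall a (by simp)).and (hsmall b (by simp)))
  obtain ⟨δ, hδ, hδ'⟩ := (((hbad a).union (hbad b)).dense_compl ℝ).exists_mem_open isOpen_Ioo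
    (nonempty_Ioo.2 hδ₀)
  simp only [mem_compl_iff, mem_union, mem_ofPred_eq, not_or, not_not] at hδ
  refine ⟨δ, hδ'.1, ?_⟩
  rintro c (rfl | rfl)
  exacts [⟨hδ.1, (hsub hδ').1⟩, ⟨hδ.2, (hsub hδ').2⟩]

theorem UniformContinuous.tendsto_sub_of_tendsto_dist {X : Type*} [PseudoMetricSpace X] {g : X → ℝ}
    (hg : UniformContinuous g) {u v : ℕ → X}
    (h : Tendsto (fun n => dist (u n) (v n)) atTop (𝓝 0)) :
    Tendsto (fun n => g (u n) - g (v n)) atTop (𝓝 0) := by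
  have := tendsto_uniformity_iff_dist_tendsto_zero.1
    (Tendsto.comp hg (tendsto_uniformity_iff_dist_tendsto_zero (f := fun n => (u n, v n)) |>.2 h))
  exact tendsto_zero_iff_abs_tendsto_zero _ |>.2 this

theorem abs_indicator_one_le_one {X : Type*} (s : Set X) (x : X) :
    |s.indicator (1 : X → ℝ) x| ≤ 1 := by
  by_cases h : x ∈ s <;> simp [h]

/-- If `(T, U)` is contracting and `U` is ergodic, then `U`-asymptotically invariant observables
multiplied by `1_B ∘ T^N` decouple from any fixed bounded observable. -/
theorem Ergodic.tendsto_integral_mul_indicator_iterate_sub {X : Type*} [MetricSpace X]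
    [MeasurableSpace X] [BorelSpace X] {μ : Measure X} [IsProbabilityMeasure μ] {T U : X → X}
    (hT : MeasurePreserving T μ μ) (hU : Ergodic U μ)
    (hcontr : ∀ᵐ x ∂μ, Tendsto (fun n => dist (T^[n] (U x)) (T^[n] x)) atTop (𝓝 0))
    {ψ : ℕ → X → ℝ} (hψm : ∀ N, Measurable (ψ N)) (hψb : ∀ N x, |ψ N x| ≤ 1)
    (hψ : ∀ᵐ x ∂μ, Tendsto (fun N => ψ N (U x) - ψ N x) atTop (𝓝 0))
    {a : X → ℝ} (ham : Measurable a) (hab : ∀ x, |a x| ≤ 1) {B : Set X} (hB : MeasurableSet B) :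
    Tendsto (fun N => (∫ x, a x * (B.indicator 1 (T^[N] x) * ψ N x) ∂μ)
      - (∫ x, a x ∂μ) * ∫ x, B.indicator 1 (T^[N] x) * ψ N x ∂μ) atTop (𝓝 0) := by
  refine tendsto_zero_of_forall_eventually_abs_sub_le fun ε hε => ?_
  obtain ⟨g, hg, hgb, hgε⟩ :=
    exists_uniformContinuous_integral_abs_sub_indicator_le μ hB (half_pos hε)
  have hgm : Measurable g := hg.continuous.measurable
  have hTm : ∀ N, Measurable T^[N] := fun N => (hT.iterate N).measurable
  have hmulb : ∀ {s t : ℝ}, |s| ≤ 1 → |t| ≤ 1 → |s * t| ≤ 1 := fun hs ht => by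
    rw [abs_mul]; exact mul_le_one₀ hs (abs_nonneg _) ht
  have hbdd : ∀ {k : X → ℝ}, Measurable k → (∀ x, |k x| ≤ 1) → Integrable k μ := fun hk hb =>
    Integrable.of_bound hk.aestronglyMeasurable 1 (.of_forall hb)
  refine ⟨_, hU.tendsto_integral_mul_sub (τ := fun _ => id)
    (φ := fun N x => g (T^[N] x) * ψ N x) (fun _ => .id μ) (fun _ _ => rfl)
    (fun N => (hgm.comp (hTm N)).mul (hψm N)) (fun N x => hmulb (hgb _) (hψb N x)) ?_ ham hab,
    .of_forall fun N => ?_⟩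
  · filter_upwards [hcontr, hψ] with x hx hψx
    have h1 := (hg.tendsto_sub_of_tendsto_dist hx).abs.add hψx.abs
    simp only [abs_zero, add_zero] at h1
    refine squeeze_zero_norm (fun N => ?_) h1
    have e : g (T^[N] (U x)) * ψ N (U x) - g (T^[N] x) * ψ N x
        = (g (T^[N] (U x)) - g (T^[N] x)) * ψ N x
          + g (T^[N] (U x)) * (ψ N (U x) - ψ N x) := by ring
    rw [e]
    refine (norm_add_le _ _).trans (add_le_add ?_ ?_)
    · rw [norm_mul]
      exact mul_le_of_le_one_right (norm_nonneg _) (hψb N x)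
    · rw [norm_mul]
      exact mul_le_of_le_one_left (norm_nonneg _) (hgb _)
  · have hindm : Measurable (B.indicator (1 : X → ℝ)) := measurable_one.indicator hB
    have key : ∀ {c : X → ℝ}, Measurable c → (∀ x, |c x| ≤ 1) →
        |(∫ x, c x * (B.indicator 1 (T^[N] x) * ψ N x) ∂μ)
          - ∫ x, c x * (g (T^[N] x) * ψ N x) ∂μ| ≤ ε / 2 := by
      intro c hc hcb
      have i1 : Integrable (fun x => c x * (B.indicator 1 (T^[N] x) * ψ N x)) μ :=
        hbdd (hc.mul ((hindm.comp (hTm N)).mul (hψm N))) fun x =>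
          hmulb (hcb x) (hmulb (abs_indicator_one_le_one B _) (hψb N x))
      have i2 : Integrable (fun x => c x * (g (T^[N] x) * ψ N x)) μ :=
        hbdd (hc.mul ((hgm.comp (hTm N)).mul (hψm N))) fun x =>
          hmulb (hcb x) (hmulb (hgb _) (hψb N x))
      have hd : Integrable (fun x => |B.indicator 1 x - g x|) μ :=
        ((hbdd hindm (abs_indicator_one_le_one B)).sub (hbdd hgm hgb)).abs
      have e := integral_map (hT.iterate N).aemeasurable (f := fun x => |B.indicator 1 x - g x|)
        (hindm.sub hgm).abs.aestronglyMeasurable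
      rw [(hT.iterate N).map_eq] at e
      rw [← integral_sub i1 i2]
      refine abs_integral_le_integral_abs.trans (le_trans ?_ hgε)
      rw [e]
      refine integral_mono (i1.sub i2).abs ((hT.iterate N).integrable_comp_of_integrable hd)
        fun x => ?_
      simp only [← mul_sub, ← sub_mul, abs_mul]
      exact (mul_le_of_le_one_left (by positivity) (hcb x)).trans
        (mul_le_of_le_one_right (abs_nonneg _) (hψb N x))
    have k1 := key ham hab
    have k2 := key (c := fun _ => 1) measurable_const (by simp)
    simp only [one_mul] at k2
    have ha1 : |∫ x, a x ∂μ| ≤ 1 := by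
      simpa using norm_integral_le_of_norm_le_const (μ := μ) (f := a) (C := 1) (.of_forall hab)
    have k3 := mul_le_mul ha1 k2 (abs_nonneg _) zero_le_one
    rw [← abs_mul, one_mul, mul_sub] at k3
    simp only [id]
    rw [abs_le] at k1 k3 ⊢
    constructor <;> linarith [k1.1, k1.2, k3.1, k3.2]

/-- A map which contracts along an ergodic measure-preserving map is ergodic. -/
theorem Ergodic.of_contracting {X : Type*} [MetricSpace X]
    [MeasurableSpace X] [BorelSpace X] {μ : Measure X} [IsProbabilityMeasure μ] {T U : X → X}
    (hT : MeasurePreserving T μ μ) (hU : Ergodic U μ)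
    (hcontr : ∀ᵐ x ∂μ, Tendsto (fun n => dist (T^[n] (U x)) (T^[n] x)) atTop (𝓝 0)) :
    Ergodic T μ := by
  refine ⟨hT, ⟨fun s hs hTs => ?_⟩⟩
  have hlim := hU.tendsto_integral_mul_indicator_iterate_sub hT hcontr (ψ := fun _ _ => 1)
    (fun _ => measurable_const) (by simp) (by simp) (a := s.indicator 1)
    (measurable_one.indicator hs) (abs_indicator_one_le_one s) hs
  have hiter : ∀ N x, s.indicator (1 : X → ℝ) (T^[N] x) = s.indicator 1 x := by
    intro N x
    have : T^[N] ⁻¹' s = s := by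
      rw [preimage_iterate_eq]
      exact Function.iterate_fixed hTs N
    rw [← indicator_comp_right (g := (1 : X → ℝ)) (f := T^[N]), this]
    rfl
  have hsq : ∀ x, s.indicator (1 : X → ℝ) x * s.indicator 1 x = s.indicator 1 x := by
    intro x
    by_cases h : x ∈ s <;> simp [h]
  simp only [hiter, mul_one, hsq, integral_indicator_one hs] at hlim
  have h0 := tendsto_nhds_unique tendsto_const_nhds hlim
  have h1 : μ.real s = 0 ∨ μ.real s = 1 := by
    have : μ.real s * (μ.real s - 1) = 0 := by linarith
    rcases mul_eq_zero.1 this with h | h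
    exacts [.inl h, .inr (sub_eq_zero.1 h)]
  rw [eventuallyConst_set']
  rcases h1 with h | h
  · exact .inl (ae_eq_empty.2 ((measureReal_eq_zero_iff).1 h))
  · right
    rw [ae_eq_univ, prob_compl_eq_zero_iff hs]
    simpa [measureReal_def, ENNReal.toReal_eq_one_iff] using h

/-- Decoupling of the past, a smooth function of the present statistic, and the future. -/
theorem Ergodic.tendsto_integral_mul_indicator_mul_comp_sub {X : Type*} [MetricSpace X]
    [MeasurableSpace X] [BorelSpace X] {μ : Measure X} [IsProbabilityMeasure μ] {T U : X → X}
    (hT : MeasurePreserving T μ μ) (hU : Ergodic U μ)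
    (hcontr : ∀ᵐ x ∂μ, Tendsto (fun n => dist (T^[n] (U x)) (T^[n] x)) atTop (𝓝 0))
    {σ : ℕ → X → ℝ} (hσm : ∀ N, Measurable (σ N))
    (hσU : ∀ᵐ x ∂μ, Tendsto (fun N => dist (σ N (U x)) (σ N x)) atTop (𝓝 0))
    (hσT : ∀ᵐ x ∂μ, Tendsto (fun N => dist (σ N (T x)) (σ N x)) atTop (𝓝 0))
    {h : ℝ → ℝ} (hh : UniformContinuous h) (hhb : ∀ t, |h t| ≤ 1)
    {a : X → ℝ} (ham : Measurable a) (hab : ∀ x, |a x| ≤ 1) {B : Set X} (hB : MeasurableSet B) :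
    Tendsto (fun N => (∫ x, a x * (B.indicator 1 (T^[N] x) * h (σ N x)) ∂μ)
      - (∫ x, a x ∂μ) * μ.real B * ∫ x, h (σ N x) ∂μ) atTop (𝓝 0) := by
  have hm : ∀ N, Measurable fun x => h (σ N x) := fun N => hh.continuous.measurable.comp (hσm N)
  have h1 := hU.tendsto_integral_mul_indicator_iterate_sub hT hcontr hm (fun N x => hhb _)
    (hσU.mono fun x hx => hh.tendsto_sub_of_tendsto_dist hx) ham hab hB
  have h2 := (hU.of_contracting hT hcontr).tendsto_integral_mul_sub (τ := fun N => T^[N])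
    (fun N => hT.iterate N) (fun N x => (Function.iterate_succ_apply _ _ _).symm.trans
      (Function.iterate_succ_apply' _ _ _)) hm (fun N x => hhb _)
    (hσT.mono fun x hx => hh.tendsto_sub_of_tendsto_dist hx)
    (measurable_one.indicator hB) (abs_indicator_one_le_one B)
  rw [integral_indicator_one hB] at h2
  have h3 := h1.add (h2.const_mul (∫ x, a x ∂μ))
  rw [mul_zero, add_zero] at h3
  refine h3.congr fun N => ?_
  ring

theorem abs_indicator_Ioo_sub_thickenedIndicator_le {a b δ : ℝ} (hδ : 0 < δ) (t : ℝ) :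
    |(Ioo a b).indicator 1 t - (thickenedIndicator hδ (Ioo a b) t : ℝ)|
      ≤ (Ioo (a - δ) (a + δ)).indicator 1 t + (Ioo (b - δ) (b + δ)).indicator 1 t := by
  have hnn : ∀ s : Set ℝ, 0 ≤ s.indicator (1 : ℝ → ℝ) t := fun s =>
    indicator_nonneg (fun _ _ => zero_le_one) t
  by_cases ht : t ∈ Ioo a b
  · rw [thickenedIndicator_one hδ _ ht, indicator_of_mem ht]
    simpa using add_nonneg (hnn _) (hnn _)
  rw [indicator_of_notMem ht, zero_sub, abs_neg]
  by_cases htt : t ∈ Metric.thickening δ (Ioo a b)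
  · refine (abs_coe_thickenedIndicator_le_one hδ _ t).trans ?_
    obtain ⟨z, hz, htz⟩ := Metric.mem_thickening_iff.1 htt
    rw [Real.dist_eq, abs_lt] at htz
    rcases le_or_gt t a with hta | hta
    · rw [indicator_of_mem (show t ∈ Ioo (a - δ) (a + δ) from
        ⟨by linarith [hz.1], by linarith⟩)]
      exact le_add_of_nonneg_right (hnn _)
    · have htb : b ≤ t := not_lt.1 fun h => ht ⟨hta, h⟩
      rw [indicator_of_mem (show t ∈ Ioo (b - δ) (b + δ) from
        ⟨by linarith, by linarith [hz.2]⟩)]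
      exact le_add_of_nonneg_left (hnn _)
  · rw [thickenedIndicator_zero hδ _ htt]
    simpa using add_nonneg (hnn _) (hnn _)

/-- The mixing limit theorem for a general sequence of statistics which is asymptotically invariant
under both `U` and `T`. -/
theorem Ergodic.tendsto_measureReal_inter_of_contracting {X : Type*} [MetricSpace X]
    [MeasurableSpace X] [BorelSpace X] {μ : Measure X} [IsProbabilityMeasure μ] {T U : X → X}
    (hT : MeasurePreserving T μ μ) (hU : Ergodic U μ)
    (hcontr : ∀ᵐ x ∂μ, Tendsto (fun n => dist (T^[n] (U x)) (T^[n] x)) atTop (𝓝 0))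
    {σ : ℕ → X → ℝ} (hσm : ∀ N, Measurable (σ N))
    (hσU : ∀ᵐ x ∂μ, Tendsto (fun N => dist (σ N (U x)) (σ N x)) atTop (𝓝 0))
    (hσT : ∀ᵐ x ∂μ, Tendsto (fun N => dist (σ N (T x)) (σ N x)) atTop (𝓝 0))
    {S : Measure ℝ} [IsProbabilityMeasure S]
    (hσ : ∀ a b : ℝ, S {a, b} = 0 →
      Tendsto (fun N => μ.real (σ N ⁻¹' Ioo a b)) atTop (𝓝 (S.real (Ioo a b))))
    {A B : Set X} (hA : MeasurableSet A) (hB : MeasurableSet B) {a b : ℝ} (hab : S {a, b} = 0) :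
    Tendsto (fun N => μ.real (A ∩ (T^[N] ⁻¹' B ∩ σ N ⁻¹' Ioo a b))) atTop
      (𝓝 (μ.real A * μ.real B * S.real (Ioo a b))) := by
  have hTm : ∀ N, Measurable T^[N] := fun N => (hT.iterate N).measurable
  have hind : ∀ {s : Set X}, MeasurableSet s → Measurable (s.indicator (1 : X → ℝ)) := fun hs =>
    measurable_one.indicator hs
  have hindR : ∀ c d : ℝ, Measurable ((Ioo c d).indicator (1 : ℝ → ℝ)) :=
    fun _ _ => measurable_one.indicator measurableSet_Ioo
  have hmulb : ∀ {s t : ℝ}, |s| ≤ 1 → |t| ≤ 1 → |s * t| ≤ 1 := fun hs ht => by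
    rw [abs_mul]; exact mul_le_one₀ hs (abs_nonneg _) ht
  have hbdd : ∀ {k : X → ℝ}, Measurable k → (∀ x, |k x| ≤ 1) → Integrable k μ := fun hk hb =>
    Integrable.of_bound hk.aestronglyMeasurable 1 (.of_forall hb)
  have hσI : ∀ N c d, MeasurableSet (σ N ⁻¹' Ioo c d) := fun N c d => hσm N measurableSet_Ioo
  have e1 : ∀ N c d, ∫ x, (Ioo c d).indicator 1 (σ N x) ∂μ = μ.real (σ N ⁻¹' Ioo c d) :=
    fun N c d => integral_indicator_one (hσI N c d)
  have i1 : ∀ N c d, Integrable (fun x => (Ioo c d).indicator (1 : ℝ → ℝ) (σ N x)) μ :=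
    fun N c d => hbdd ((hindR _ _).comp (hσm N)) fun x => abs_indicator_one_le_one _ _
  have e2 : ∀ N, ∫ x, A.indicator 1 x * (B.indicator 1 (T^[N] x) *
      (Ioo a b).indicator 1 (σ N x)) ∂μ = μ.real (A ∩ (T^[N] ⁻¹' B ∩ σ N ⁻¹' Ioo a b)) := by
    intro N
    rw [← integral_indicator_one (hA.inter ((hTm N hB).inter (hσI N a b)))]
    simp only [inter_indicator_one]
    rfl
  suffices hz : Tendsto (fun N => μ.real (A ∩ (T^[N] ⁻¹' B ∩ σ N ⁻¹' Ioo a b))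
      - μ.real A * μ.real B * μ.real (σ N ⁻¹' Ioo a b)) atTop (𝓝 0) by
    simpa using hz.add ((hσ a b hab).const_mul (μ.real A * μ.real B))
  refine tendsto_zero_of_forall_eventually_abs_sub_le fun ε hε => ?_
  obtain ⟨δ, hδ, hδS⟩ := exists_pos_measureReal_Ioo_lt S hab (ε := ε / 4) (by positivity)
  have hh := uniformContinuous_coe_thickenedIndicator hδ (Ioo a b)
  have hhb := abs_coe_thickenedIndicator_le_one hδ (Ioo a b)
  refine ⟨_, hU.tendsto_integral_mul_indicator_mul_comp_sub hT hcontr hσm hσU hσT hh hhb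
    (hind hA) (abs_indicator_one_le_one A) hB, ?_⟩
  obtain ⟨ha0, ha⟩ := hδS a (by simp)
  obtain ⟨hb0, hb⟩ := hδS b (by simp)
  filter_upwards [(hσ _ _ ha0).eventually_lt_const ha, (hσ _ _ hb0).eventually_lt_const hb]
    with N hNa hNb
  have hm : Measurable fun x => (thickenedIndicator hδ (Ioo a b) (σ N x) : ℝ) :=
    hh.continuous.measurable.comp (hσm N)
  have key : ∀ {c : X → ℝ}, Measurable c → (∀ x, |c x| ≤ 1) →
      |(∫ x, c x * (Ioo a b).indicator 1 (σ N x) ∂μ)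
        - ∫ x, c x * (thickenedIndicator hδ (Ioo a b) (σ N x) : ℝ) ∂μ| ≤ ε / 2 := by
    intro c hc hcb
    have j1 : Integrable (fun x => c x * (Ioo a b).indicator 1 (σ N x)) μ :=
      hbdd (hc.mul ((hindR _ _).comp (hσm N))) fun x => hmulb (hcb x) (abs_indicator_one_le_one _ _)
    have j2 : Integrable (fun x => c x * (thickenedIndicator hδ (Ioo a b) (σ N x) : ℝ)) μ :=
      hbdd (hc.mul hm) fun x => hmulb (hcb x) (hhb _)
    rw [← integral_sub j1 j2]
    calc _ ≤ ∫ x, ((Ioo (a - δ) (a + δ)).indicator 1 (σ N x)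
          + (Ioo (b - δ) (b + δ)).indicator 1 (σ N x)) ∂μ := by
          refine abs_integral_le_integral_abs.trans
            (integral_mono (j1.sub j2).abs ((i1 _ _ _).add (i1 _ _ _)) fun x => ?_)
          simp only [← mul_sub, abs_mul]
          exact (mul_le_of_le_one_left (abs_nonneg _) (hcb x)).trans
            (abs_indicator_Ioo_sub_thickenedIndicator_le hδ _)
      _ = μ.real (σ N ⁻¹' Ioo (a - δ) (a + δ)) + μ.real (σ N ⁻¹' Ioo (b - δ) (b + δ)) := by
          rw [integral_add (i1 _ _ _) (i1 _ _ _), e1, e1]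
      _ ≤ ε / 2 := by linarith
  have k1 := key (c := fun x => A.indicator 1 x * B.indicator 1 (T^[N] x))
    ((hind hA).mul ((hind hB).comp (hTm N)))
    fun x => hmulb (abs_indicator_one_le_one _ _) (abs_indicator_one_le_one _ _)
  simp only [mul_assoc] at k1
  rw [e2] at k1
  have k2 := key (c := fun _ => 1) measurable_const (by simp)
  simp only [one_mul] at k2
  rw [e1] at k2
  have hAB : |μ.real A * μ.real B| ≤ 1 :=
    hmulb (by rw [abs_of_nonneg measureReal_nonneg]; exact measureReal_le_one)
      (by rw [abs_of_nonneg measureReal_nonneg]; exact measureReal_le_one)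
  have k3 := mul_le_mul hAB k2 (abs_nonneg _) zero_le_one
  rw [← abs_mul, one_mul, mul_sub] at k3
  rw [integral_indicator_one hA]
  rw [abs_le] at k1 k3 ⊢
  constructor <;> linarith [k1.1, k1.2, k3.1, k3.2]

/-- **Theorem (theo:metric_MCLT).** Let `(X,d)` be a metric space with a Borel
probability measure `μ`, `T` an invertible measure-preserving transformation and
`f` a bounded measurable function whose normalized Birkhoff sums
`S_N(x) = (∑_{n<N} f(Tⁿx) - A_N)/V_N` converge in distribution to a law `S`, with
`V_N → ∞`. Assume there is a measure-preserving ergodic transformation `U` such that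
the pair `(T,U)` is contracting and `f` is `(T,U,𝒱)`-adapted. Then the distributional
limit theorem holds in the mixing sense: for all Borel sets `A, B` and all intervals
`(a,b)` whose endpoints are not atoms of `S`,
`μ{x ∈ A : S_N(x) ∈ (a,b), T^N x ∈ B} → μ(A) · S((a,b)) · μ(B)`. -/
theorem mixing_DLT_birkhoff
    {X : Type*} [MetricSpace X] [MeasurableSpace X] [BorelSpace X]
    (μ : Measure X) [IsProbabilityMeasure μ]
    (T : X → X) (hTbij : Function.Bijective T) (hT : MeasurePreserving T μ μ)
    (f : X → ℝ) (hfm : Measurable f) (hfb : ∃ M : ℝ, ∀ x, |f x| ≤ M)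
    (A : ℕ → ℝ) (V : ℕ → ℝ) (hVpos : ∀ N, 0 < V N) (hV : Tendsto V atTop atTop)
    (S : Measure ℝ) [IsProbabilityMeasure S]
    (SN : ℕ → X → ℝ)
    (hSN : ∀ N x, SN N x = ((∑ n ∈ Finset.range N, f (T^[n] x)) - A N) / V N)
    (hDLT : ∀ a b : ℝ, S ({a, b} : Set ℝ) = 0 →
      Tendsto (fun N => μ {x | SN N x ∈ Ioo a b}) atTop (nhds (S (Ioo a b))))
    (U : X → X) (hU : Ergodic U μ)
    (hcontr : ∀ᵐ x ∂μ,
      Tendsto (fun n => dist (T^[n] (U x)) (T^[n] x)) atTop (nhds 0))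
    (hadapted : ∀ᵐ x ∂μ,
      Tendsto
        (fun N => (∑ n ∈ Finset.range (N + 1), |f (T^[n] (U x)) - f (T^[n] x)|) / V N)
        atTop (nhds 0)) :
    ∀ A' B : Set X, MeasurableSet A' → MeasurableSet B →
      ∀ a b : ℝ, S ({a, b} : Set ℝ) = 0 →
        Tendsto (fun N => μ {x | x ∈ A' ∧ SN N x ∈ Ioo a b ∧ T^[N] x ∈ B}) atTop
          (nhds (μ A' * S (Ioo a b) * μ B)) := by
  intro A' B hA hB a b hab
  obtain ⟨M, hM⟩ := hfb
  have hσm : ∀ N, Measurable (SN N) := by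
    intro N
    rw [funext (hSN N)]
    exact ((Finset.measurable_sum _ fun n _ =>
      hfm.comp (hT.iterate n).measurable).sub_const _).div_const _
  have hσU : ∀ᵐ x ∂μ, Tendsto (fun N => dist (SN N (U x)) (SN N x)) atTop (nhds 0) := by
    filter_upwards [hadapted] with x hx
    refine squeeze_zero (fun N => dist_nonneg) (fun N => ?_) hx
    rw [Real.dist_eq, hSN, hSN, ← sub_div, sub_sub_sub_cancel_right, abs_div,
      abs_of_pos (hVpos N), ← Finset.sum_sub_distrib]
    refine div_le_div_of_nonneg_right ((Finset.abs_sum_le_sum_abs _ _).trans ?_) (hVpos N).le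
    exact Finset.sum_le_sum_of_subset_of_nonneg (Finset.range_mono N.le_succ)
      fun _ _ _ => abs_nonneg _
  have hσT : ∀ x, Tendsto (fun N => dist (SN N (T x)) (SN N x)) atTop (nhds 0) := by
    intro x
    refine squeeze_zero (fun N => dist_nonneg) (fun N => ?_)
      (Tendsto.const_div_atTop hV (2 * M))
    rw [Real.dist_eq, hSN, hSN, ← sub_div, sub_sub_sub_cancel_right, abs_div,
      abs_of_pos (hVpos N)]
    refine div_le_div_of_nonneg_right ?_ (hVpos N).le
    have e := birkhoffSum_apply_sub_birkhoffSum T f N x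
    simp only [birkhoffSum] at e
    rw [e]
    exact (abs_sub _ _).trans (by linarith [hM (T^[N] x), hM x])
  have hmain := hU.tendsto_measureReal_inter_of_contracting hT hcontr hσm hσU
    (.of_forall hσT) (fun c d hcd => (ENNReal.tendsto_toReal (measure_ne_top _ _)).comp
      (hDLT c d hcd)) hA hB hab
  refine (ENNReal.tendsto_toReal_iff (fun N => measure_ne_top _ _) (ENNReal.mul_ne_top
    (ENNReal.mul_ne_top (measure_ne_top _ _) (measure_ne_top _ _)) (measure_ne_top _ _))).1 ?_
  rw [ENNReal.toReal_mul, ENNReal.toReal_mul, mul_right_comm]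
  refine hmain.congr fun N => congrArg (fun s => (μ s).toReal) ?_
  ext x
  exact and_congr_right fun _ => and_comm
end

section
/- Let (X, 𝓑, μ) be a probability space, T : X → X an invertible, measure-preserving, ergodic transformation, and f : X → ℝ bounded measurable. Suppose S_N(x) = (∑_{n=0}^{N-1} f(T^n x) − A_N)/V_N converges in distribution to S. Then for every B ∈ 𝓑 and every interval (a,b) with ℙ(S ∈ {a,b}) = 0, lim_{N→∞} μ({x : S_N(x) ∈ (a,b) and T^N x ∈ B}) = ℙ(S ∈ (a,b))·μ(B). -/
open MeasureTheory Filter Set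

open scoped Topology ENNReal symmDiff

/-- Let `U` be a linear isometry of a Hilbert space and let `h` be a bounded sequence which is
asymptotically `U`-invariant. If `u` is orthogonal to all fixed points of `U`, then
`⟪h N, U^N u⟫ → 0`. -/
theorem LinearIsometry.tendsto_inner_iterate_of_orthogonal_fixedPoints
    {H : Type*} [NormedAddCommGroup H] [InnerProductSpace ℝ H] [CompleteSpace H]
    (U : H →ₗᵢ[ℝ] H) {h : ℕ → H} (hb : ∀ N, ‖h N‖ ≤ 1)
    (hinv : Tendsto (fun N => ‖U (h N) - h N‖) atTop (𝓝 0))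
    {u : H} (hu : ∀ z, U z = z → inner ℝ z u = 0) :
    Tendsto (fun N => inner ℝ (h N) (U^[N] u)) atTop (𝓝 0) := by
  have hadd : ∀ N v w, U^[N] (v + w) = U^[N] v + U^[N] w := fun N v w =>
    iterate_map_add U N v w
  have hsub : ∀ N v w, U^[N] (v - w) = U^[N] v - U^[N] w := fun N v w =>
    iterate_map_sub U N v w
  have hsmul : ∀ N (c : ℝ) v, U^[N] (c • v) = c • U^[N] v := fun N c v =>
    (Function.Commute.iterate_left (f := U) (g := fun w => c • w)
      (fun w => U.map_smul c w) N) v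
  have hnorm : ∀ N v, ‖U^[N] v‖ = ‖v‖ := fun N v => by
    induction N with
    | zero => rfl
    | succ N ih => rw [Function.iterate_succ_apply', U.norm_map, ih]
  let C : Submodule ℝ H :=
    { carrier := {v | Tendsto (fun N => inner ℝ (h N) (U^[N] v)) atTop (𝓝 0)}
      add_mem' := fun {v w} hv hw => by
        simpa [hadd, inner_add_right] using Tendsto.add hv hw
      zero_mem' := by
        have : ∀ N, U^[N] 0 = 0 := fun N => iterate_map_zero U N
        simp [this]
      smul_mem' := fun c v hv => by
        simpa [hsmul, inner_smul_right] using Tendsto.const_mul c hv }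
  have hmem : ∀ v, v ∈ C ↔ Tendsto (fun N => inner ℝ (h N) (U^[N] v)) atTop (𝓝 0) :=
    fun v => Iff.rfl
  have hclosed : IsClosed (C : Set H) := by
    refine isClosed_of_closure_subset fun v hv => ?_
    rw [SetLike.mem_coe, hmem, Metric.tendsto_atTop]
    intro ε hε
    obtain ⟨w, hw, hvw⟩ := Metric.mem_closure_iff.1 hv (ε / 2) (half_pos hε)
    obtain ⟨N₀, hN₀⟩ := Metric.tendsto_atTop.1 ((hmem w).1 hw) (ε / 2) (half_pos hε)
    refine ⟨N₀, fun N hN => ?_⟩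
    have h1 := hN₀ N hN
    rw [dist_zero_right, Real.norm_eq_abs] at h1 ⊢
    have h2 : |inner ℝ (h N) (U^[N] (v - w))| ≤ ‖v - w‖ := by
      refine (abs_real_inner_le_norm _ _).trans ?_
      rw [hnorm]
      exact mul_le_of_le_one_left (norm_nonneg _) (hb N)
    rw [hsub, inner_sub_right] at h2
    rw [dist_eq_norm] at hvw
    rw [abs_lt] at h1 ⊢
    rw [abs_le] at h2
    constructor <;> linarith
  have hrange : ∀ v, U v - v ∈ C := fun v => by
    rw [hmem]
    refine squeeze_zero_norm (a := fun N => ‖U (h N) - h N‖ * ‖v‖) (fun N => ?_)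
      (by simpa using hinv.mul_const ‖v‖)
    have : inner ℝ (h N) (U^[N] (U v - v)) = -inner ℝ (U (h N) - h N) (U^[N + 1] v) := by
      rw [hsub, ← Function.iterate_succ_apply, inner_sub_right, inner_sub_left,
        Function.iterate_succ_apply', U.inner_map_map]
      ring
    rw [this, norm_neg]
    exact (norm_inner_le_norm _ _).trans_eq (by rw [hnorm])
  suffices u ∈ Cᗮᗮ by
    rw [Submodule.orthogonal_orthogonal_eq_closure,
      hclosed.submodule_topologicalClosure_eq] at this
    exact this
  rw [Submodule.mem_orthogonal]
  intro z hz
  refine hu z ?_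
  have hz' : inner ℝ (U z) z = inner ℝ z z := by
    have := (Submodule.mem_orthogonal _ _).1 hz _ (hrange z)
    rwa [inner_sub_left, sub_eq_zero] at this
  refine eq_of_norm_le_re_inner_eq_norm_sq (𝕜 := ℝ) (U.norm_map z).le ?_
  simp [hz']

/-- Let `T` be an ergodic map of a probability space and let `E` be a sequence of
asymptotically `T`-invariant sets. Then the events `E N` and `T^N x ∈ B` are asymptotically
independent. -/
theorem Ergodic.tendsto_measureReal_inter_preimage_iterate
    {X : Type*} [MeasurableSpace X] {μ : Measure X} [IsProbabilityMeasure μ]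
    {T : X → X} (hT : Ergodic T μ) {E : ℕ → Set X} (hE : ∀ N, MeasurableSet (E N))
    (hinv : Tendsto (fun N => μ ((T ⁻¹' E N) ∆ E N)) atTop (𝓝 0))
    {B : Set X} (hB : MeasurableSet B) :
    Tendsto (fun N => μ.real (E N ∩ T^[N] ⁻¹' B) - μ.real (E N) * μ.real B) atTop (𝓝 0) := by
  have hmp := hT.toMeasurePreserving
  let U : Lp ℝ 2 μ →ₗᵢ[ℝ] Lp ℝ 2 μ := Lp.compMeasurePreservingₗᵢ ℝ T hmp
  let ind (s : Set X) (hs : MeasurableSet s) : Lp ℝ 2 μ :=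
    indicatorConstLp 2 hs (measure_ne_top μ s) 1
  have hU : ∀ s hs, U (ind s hs) = ind (T ⁻¹' s) (hmp.measurable hs) := fun s hs =>
    Lp.indicatorConstLp_compMeasurePreserving hs (measure_ne_top μ s) 1 hmp
  have hUN : ∀ N s hs, U^[N] (ind s hs) = ind (T^[N] ⁻¹' s) (hmp.measurable.iterate N hs) := by
    intro N
    induction N with
    | zero => intro s hs; rfl
    | succ N ih =>
      intro s hs
      rw [Function.iterate_succ_apply', ih, hU]
      rfl
  have hinner : ∀ s hs t ht, inner ℝ (ind s hs) (ind t ht) = μ.real (s ∩ t) := by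
    intro s hs t ht
    exact L2.real_inner_indicatorConstLp_one_indicatorConstLp_one hs ht
  have hnorm : ∀ s hs, ‖ind s hs‖ = μ.real s ^ (1 / 2 : ℝ) := by
    intro s hs
    simp [ind, norm_indicatorConstLp]
  let one := ind univ MeasurableSet.univ
  have hone : ∀ N, U^[N] one = one := fun N => hUN N _ _
  have key := U.tendsto_inner_iterate_of_orthogonal_fixedPoints
    (h := fun N => ind (E N) (hE N)) (u := ind B hB - μ.real B • one) ?_ ?_ ?_
  · refine key.congr fun N => ?_
    have h1 : U^[N] (ind B hB - μ.real B • one) = U^[N] (ind B hB) - μ.real B • U^[N] one := by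
      rw [iterate_map_sub U N]
      congr 1
      exact (Function.Commute.iterate_left (f := U) (g := fun w => μ.real B • w)
        (fun w => U.map_smul _ w) N) one
    rw [h1, hone, hUN, inner_sub_right, inner_smul_right, hinner, hinner, inter_univ, mul_comm]
  · intro N
    rw [hnorm]
    exact Real.rpow_le_one measureReal_nonneg measureReal_le_one (by norm_num)
  · have h1 : ∀ N, ‖U (ind (E N) (hE N)) - ind (E N) (hE N)‖
        = μ.real ((T ⁻¹' E N) ∆ E N) ^ (1 / 2 : ℝ) := by
      intro N
      rw [hU, ← hnorm _ ((hmp.measurable (hE N)).symmDiff (hE N)), ← dist_eq_norm]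
      exact dist_indicatorConstLp_eq_norm
    simp_rw [h1]
    have h2 : Tendsto (fun N => μ.real ((T ⁻¹' E N) ∆ E N)) atTop (𝓝 0) :=
      (ENNReal.tendsto_toReal ENNReal.zero_ne_top).comp hinv
    simpa using h2.rpow_const (p := 1 / 2) (Or.inr (by norm_num))
  · intro z hz
    obtain ⟨c, hc⟩ := hT.ae_eq_const_of_ae_eq_comp_ae (Lp.aestronglyMeasurable z)
      ((Lp.coeFn_compMeasurePreserving z hmp).symm.trans (by
        change (U z : X → ℝ) =ᵐ[μ] z
        rw [hz]))
    have hzc : z = c • one := by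
      refine Lp.ext ?_
      filter_upwards [hc, Lp.coeFn_smul c one,
        (indicatorConstLp_coeFn : (one : X → ℝ) =ᵐ[μ] univ.indicator fun _ => (1 : ℝ))] with x h1 h2 h3
      rw [h1, h2, Pi.smul_apply, h3]
      simp
    rw [hzc, inner_smul_left, inner_sub_right, inner_smul_right, hinner, hinner]
    simp

/-- A point which is not an atom of a finite measure on `ℝ` has symmetric neighbourhoods of
arbitrarily small measure whose endpoints are not atoms. -/
theorem MeasureTheory.Measure.exists_Ioo_lt_of_singleton_eq_zero (S : Measure ℝ)
    [IsFiniteMeasure S] {c : ℝ} (hc : S {c} = 0) {ε : ℝ≥0∞} (hε : 0 < ε) :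
    ∃ r > 0, S {c - r, c + r} = 0 ∧ S (Ioo (c - r) (c + r)) < ε := by
  obtain ⟨r, hr, hr'⟩ := exists_null_frontiers_thickening S {c}
  have h0 : Tendsto r atTop (𝓝[>] 0) :=
    tendsto_nhdsWithin_iff.2 ⟨hr, Eventually.of_forall fun n => (hr' n).1⟩
  have h1 := (tendsto_measure_thickening_of_isClosed (μ := S) (s := {c})
    ⟨1, one_pos, measure_ne_top _ _⟩ isClosed_singleton).comp h0
  rw [hc] at h1
  obtain ⟨n, hn⟩ := (h1.eventually (gt_mem_nhds hε)).exists
  obtain ⟨hpos, hfr⟩ := hr' n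
  refine ⟨r n, hpos, ?_, ?_⟩
  · rwa [Metric.thickening_singleton, Real.ball_eq_Ioo, frontier_Ioo (by linarith)] at hfr
  · simpa [Metric.thickening_singleton, Real.ball_eq_Ioo] using hn

/-- If `Y N` converges in distribution to `S` and `c` is not an atom of `S`, then `Y N` is
unlikely to be in a shrinking neighbourhood of `c`. -/
theorem MeasureTheory.tendsto_measure_abs_sub_le_of_tendsto_Ioo
    {X : Type*} [MeasurableSpace X] {μ : Measure X} {S : Measure ℝ} [IsFiniteMeasure S]
    {Y : ℕ → X → ℝ}
    (hY : ∀ a b : ℝ, S ({a, b} : Set ℝ) = 0 →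
      Tendsto (fun N => μ {x | Y N x ∈ Ioo a b}) atTop (𝓝 (S (Ioo a b))))
    {c : ℝ} (hc : S {c} = 0) {δ : ℕ → ℝ} (hδ : Tendsto δ atTop (𝓝 0)) :
    Tendsto (fun N => μ {x | |Y N x - c| ≤ δ N}) atTop (𝓝 0) := by
  refine ENNReal.tendsto_nhds_zero.2 fun ε hε => ?_
  obtain ⟨r, hr, hr0, hrε⟩ := S.exists_Ioo_lt_of_singleton_eq_zero hc hε
  filter_upwards [(hY _ _ hr0).eventually (gt_mem_nhds hrε), hδ.eventually (gt_mem_nhds hr)]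
    with N h1 h2
  refine (measure_mono fun x hx => ?_).trans h1.le
  have := abs_le.1 (show |Y N x - c| ≤ δ N from hx)
  constructor <;> linarith

/-- **Corollary (cor:tech, first part).** If the normalized Birkhoff sums
`S_N(x) = (∑_{n<N} f(Tⁿx) - A_N)/V_N` of a bounded measurable function over an
invertible, measure-preserving, ergodic transformation converge in distribution to a
law `S`, then for every measurable set `B` and every interval `(a,b)` whose endpoints
are not atoms of `S`, `μ{x : S_N(x) ∈ (a,b), T^N x ∈ B} → S((a,b)) · μ(B)`. -/
theorem conditional_DLT_birkhoff_endpoint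
    {X : Type*} [MeasurableSpace X] (μ : Measure X) [IsProbabilityMeasure μ]
    (T : X → X) (hTbij : Function.Bijective T) (hT : Ergodic T μ)
    (f : X → ℝ) (hfm : Measurable f) (hfb : ∃ M : ℝ, ∀ x, |f x| ≤ M)
    (A : ℕ → ℝ) (V : ℕ → ℝ) (hVpos : ∀ N, 0 < V N) (hV : Tendsto V atTop atTop)
    (S : Measure ℝ) [IsProbabilityMeasure S]
    (SN : ℕ → X → ℝ)
    (hSN : ∀ N x, SN N x = ((∑ n ∈ Finset.range N, f (T^[n] x)) - A N) / V N)
    (hDLT : ∀ a b : ℝ, S ({a, b} : Set ℝ) = 0 →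
      Tendsto (fun N => μ {x | SN N x ∈ Ioo a b}) atTop (nhds (S (Ioo a b)))) :
    ∀ B : Set X, MeasurableSet B → ∀ a b : ℝ, S ({a, b} : Set ℝ) = 0 →
      Tendsto (fun N => μ {x | SN N x ∈ Ioo a b ∧ T^[N] x ∈ B}) atTop
        (nhds (S (Ioo a b) * μ B)) := by
  intro B hB a b hab
  obtain ⟨M, hM⟩ := hfb
  have hSNm : ∀ N, Measurable (SN N) := fun N => by
    have : SN N = fun x => ((∑ n ∈ Finset.range N, f (T^[n] x)) - A N) / V N :=
      funext (hSN N)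
    rw [this]
    exact ((Finset.measurable_sum _ fun n _ =>
      hfm.comp (hT.measurable.iterate n)).sub_const _).div_const _
  have hE : ∀ N, MeasurableSet {x | SN N x ∈ Ioo a b} := fun N => hSNm N measurableSet_Ioo
  have hclose : ∀ N x, |SN N (T x) - SN N x| ≤ 2 * M / V N := fun N x => by
    have h1 : SN N (T x) - SN N x = (f (T^[N] x) - f x) / V N := by
      have h2 := Finset.sum_range_succ (fun n => f (T^[n] x)) N
      rw [Finset.sum_range_succ'] at h2
      simp only [Function.iterate_succ_apply, Function.iterate_zero, id] at h2
      rw [hSN, hSN, ← sub_div]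
      congr 1
      linarith
    rw [h1, abs_div, abs_of_pos (hVpos N)]
    refine div_le_div_of_nonneg_right ?_ (hVpos N).le
    have h2 := abs_le.1 (hM (T^[N] x))
    have h3 := abs_le.1 (hM x)
    rw [abs_le]
    constructor <;> linarith
  have hδ : Tendsto (fun N => 2 * M / V N) atTop (𝓝 0) := hV.const_div_atTop _
  have hnear := (tendsto_measure_abs_sub_le_of_tendsto_Ioo hDLT
    (measure_mono_null (by simp) hab : S {a} = 0) hδ).add
    (tendsto_measure_abs_sub_le_of_tendsto_Ioo hDLT
    (measure_mono_null (by simp) hab : S {b} = 0) hδ)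
  rw [add_zero] at hnear
  have hinv : Tendsto (fun N => μ ((T ⁻¹' {x | SN N x ∈ Ioo a b}) ∆ {x | SN N x ∈ Ioo a b}))
      atTop (𝓝 0) := by
    refine tendsto_of_tendsto_of_tendsto_of_le_of_le tendsto_const_nhds hnear
      (fun N => zero_le) fun N => (measure_mono fun x hx => ?_).trans (measure_union_le _ _)
    have h1 := abs_le.1 (hclose N x)
    simp only [mem_union, mem_ofPred_eq, abs_le]
    rcases hx with ⟨⟨h2, h3⟩, h4⟩ | ⟨⟨h2, h3⟩, h4⟩
    · rcases le_or_gt (SN N x) a with h5 | h5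
      · left; constructor <;> linarith
      · have h6 : b ≤ SN N x := not_lt.1 fun h => h4 ⟨h5, h⟩
        right; constructor <;> linarith
    · rcases le_or_gt (SN N (T x)) a with h5 | h5
      · left; constructor <;> linarith
      · have h6 : b ≤ SN N (T x) := not_lt.1 fun h => h4 ⟨h5, h⟩
        right; constructor <;> linarith
  have hreal : Tendsto (fun N => μ.real {x | SN N x ∈ Ioo a b}) atTop (𝓝 (S.real (Ioo a b))) :=
    (ENNReal.tendsto_toReal (measure_ne_top _ _)).comp (hDLT a b hab)
  have hlim := (hT.tendsto_measureReal_inter_preimage_iterate hE hinv hB).add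
    (hreal.mul_const (μ.real B))
  simp only [sub_add_cancel, zero_add] at hlim
  rw [← ENNReal.tendsto_toReal_iff (fun N => measure_ne_top _ _) (by finiteness),
    ENNReal.toReal_mul]
  exact hlim
end
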